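/- Refined bound for odd-power kernel integrals against C¹ densities: let m > 0 be an odd integer and let g ∈ C¹(ℝ/ℤ; ℝ³). There exist constants C > 0 and ε₀ > 0, depending only on m, n, c_Γ, and κ_max, such that for all 0 < ε < ε₀, 0 < δ < ε₀, every s ∈ ℝ/ℤ and θ ∈ [0,2π): if n = m + 1 then |∫_{−1/2}^{1/2} s̄^m / (|R(s,s̄,θ)|² + δ²)^{n/2} g(s̄) ds̄| ≤ C ‖g‖_{C¹} |log(ε² + δ²)|, and if n ≥ m + 3 then |∫_{−1/2}^{1/2} s̄^m / (|R(s,s̄,θ)|² + δ²)^{n/2} g(s̄) ds̄| ≤ C ‖g‖_{C¹} (ε² + δ²)^{(m+2−n)/2}. -/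

import Mathlib

open MeasureTheory

noncomputable section

local notation "⟪" x ", " y "⟫" => @inner ℝ _ _ x y

abbrev V3 : Type := EuclideanSpace ℝ (Fin 3)

/-- The `C⁰` (sup) norm of a function `ℝ/ℤ → ℝ³`. -/
def C0norm (f : ℝ → V3) : ℝ := ⨆ s : ℝ, ‖f s‖

/-- The `C¹` norm of a function `ℝ/ℤ → ℝ³`. -/
def C1norm (f : ℝ → V3) : ℝ := C0norm f + C0norm (deriv f)

/-- The radial unit vector `e_ρ(s,θ) = cos θ e_{n1}(s) + sin θ e_{n2}(s)`. -/
def ePerp (en1 en2 : ℝ → V3) (s θ : ℝ) : V3 :=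
  Real.cos θ • en1 s + Real.sin θ • en2 s

/-- `R(s, s̄, θ) = X(s) + ε e_ρ(s,θ) − X(s − s̄)`. -/
def Rvec (X en1 en2 : ℝ → V3) (ε s sb θ : ℝ) : V3 :=
  X s + ε • ePerp en1 en2 s θ - X (s - sb)

/-- The slender-body geometry hypotheses: `X : ℝ/ℤ → ℝ³` is a `C²` closed curve
parameterized by arclength, non-self-intersecting with constant `cΓ`, with curvature
bounded by `κmax`, together with a `C¹` orthonormal frame `(X', en1, en2)`. -/
structure SlenderGeom (cΓ κmax : ℝ) (X en1 en2 : ℝ → V3) : Prop where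
  smooth : ContDiff ℝ 2 X
  periodicX : ∀ s, X (s + 1) = X s
  arclength : ∀ s, ‖deriv X s‖ = 1
  no_self_intersect : ∀ s t : ℝ, |s - t| ≤ 1 / 2 → cΓ * |s - t| ≤ ‖X s - X t‖
  curvature_max : ∀ s, ‖deriv (deriv X) s‖ ≤ κmax
  en1_smooth : ContDiff ℝ 1 en1
  en2_smooth : ContDiff ℝ 1 en2
  en1_periodic : ∀ s, en1 (s + 1) = en1 s
  en2_periodic : ∀ s, en2 (s + 1) = en2 s
  en1_unit : ∀ s, ‖en1 s‖ = 1
  en2_unit : ∀ s, ‖en2 s‖ = 1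
  es_en1 : ∀ s, ⟪deriv X s, en1 s⟫ = 0
  es_en2 : ∀ s, ⟪deriv X s, en2 s⟫ = 0
  en1_en2 : ∀ s, ⟪en1 s, en2 s⟫ = 0

/-- The singular Stokeslet `S(y) v = v/|y| + (y·v) y/|y|³`. -/
def stokeslet (y v : V3) : V3 := ‖y‖⁻¹ • v + (‖y‖ ^ 3)⁻¹ • ⟪y, v⟫ • y

/-- The singular doublet `D(y) v = v/|y|³ − 3 (y·v) y/|y|⁵`. -/
def doubletK (y v : V3) : V3 := (‖y‖ ^ 3)⁻¹ • v - (3 * (‖y‖ ^ 5)⁻¹) • ⟪y, v⟫ • y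

/-- The regularized Stokeslet `S_δ(y) v`. -/
def stokesletReg (δ : ℝ) (y v : V3) : V3 :=
  ((‖y‖ ^ 2 + δ ^ 2) ^ ((1 : ℝ) / 2))⁻¹ • v
    + ((‖y‖ ^ 2 + δ ^ 2) ^ ((3 : ℝ) / 2))⁻¹ • (⟪y, v⟫ • y + δ ^ 2 • v)

/-- The regularized doublet `D_δ(y) v`. -/
def doubletReg (δ : ℝ) (y v : V3) : V3 :=
  ((‖y‖ ^ 2 + δ ^ 2) ^ ((3 : ℝ) / 2))⁻¹ • v
    - (3 * ((‖y‖ ^ 2 + δ ^ 2) ^ ((5 : ℝ) / 2))⁻¹) • (⟪y, v⟫ • y + δ ^ 2 • v)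

/-- The classical slender-body velocity `u^SB(x)` with doublet coefficient `ε²/2`. -/
def uSB (X f : ℝ → V3) (ε : ℝ) (x : V3) : V3 :=
  (8 * Real.pi)⁻¹ • ∫ t in (0:ℝ)..1,
    (stokeslet (x - X t) (f t) + (ε ^ 2 / 2) • doubletK (x - X t) (f t))

/-- The regularized slender-body velocity with doublet coefficient `β`. -/
def uReg (X f : ℝ → V3) (β δ : ℝ) (x : V3) : V3 :=
  (8 * Real.pi)⁻¹ • ∫ t in (0:ℝ)..1,
    (stokesletReg δ (x - X t) (f t) + β • doubletReg δ (x - X t) (f t))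

/-- The Keller–Rubinow classical centerline velocity `u^SB_C(X(s))`. -/
def uSBC (X f : ℝ → V3) (ε s : ℝ) : V3 :=
  (8 * Real.pi)⁻¹ •
    ((f s - (3 : ℝ) • ⟪deriv X s, f s⟫ • deriv X s
        - (2 * Real.log (Real.pi * ε / 4)) • (f s + ⟪deriv X s, f s⟫ • deriv X s))
      + ∫ t in (0:ℝ)..1,
          ((‖X s - X t‖⁻¹ • f t
              + (‖X s - X t‖ ^ 3)⁻¹ • ⟪X s - X t, f t⟫ • (X s - X t))
            - |Real.sin (Real.pi * (s - t)) / Real.pi|⁻¹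
                • (f s + ⟪deriv X s, f s⟫ • deriv X s)))

/-- The regularized pressure `p^δ(x)`. -/
def pReg (X f : ℝ → V3) (δ : ℝ) (x : V3) : ℝ :=
  (4 * Real.pi)⁻¹ * ∫ t in (0:ℝ)..1,
    (⟪x - X t, f t⟫ * ((‖x - X t‖ ^ 2 + δ ^ 2) ^ ((3 : ℝ) / 2))⁻¹
      + 3 * δ ^ 2 * ⟪x - X t, f t⟫ * (2 * (‖x - X t‖ ^ 2 + δ ^ 2) ^ ((5 : ℝ) / 2))⁻¹)

/-- The symmetric strain tensor `E(u) = (∇u + (∇u)ᵀ)/2` applied to the vector `n`. -/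
def strainApply (u : V3 → V3) (x n : V3) : V3 :=
  (2 : ℝ)⁻¹ • (fderiv ℝ u x n + gradient (fun y => ⟪u y, n⟫) x)

/-- The surface Jacobian `J_ε(s,θ) = ε(1 − ε(κ₁ cos θ + κ₂ sin θ))`. -/
def Jfac (X en1 en2 : ℝ → V3) (ε s θ : ℝ) : ℝ :=
  ε * (1 - ε * (⟪deriv (deriv X) s, en1 s⟫ * Real.cos θ
      + ⟪deriv (deriv X) s, en2 s⟫ * Real.sin θ))

/-- The regularized surface force density
`f^δ(s) = ∫_0^{2π} (2 E(u^δ) n − p^δ n) J_ε dθ`, with `n = −e_ρ`. -/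
def fReg (X en1 en2 f : ℝ → V3) (ε δ s : ℝ) : V3 :=
  ∫ θ in (0:ℝ)..(2 * Real.pi),
    Jfac X en1 en2 ε s θ •
      ((2 : ℝ) • strainApply (uReg X f ((ε ^ 2 + δ ^ 2) / 2) δ)
          (X s + ε • ePerp en1 en2 s θ) (-ePerp en1 en2 s θ)
        - pReg X f δ (X s + ε • ePerp en1 en2 s θ) • (-ePerp en1 en2 s θ))

/-- The vector field `d_n^δ[f](x)`. -/
def dReg (X f : ℝ → V3) (δ : ℝ) (n : ℕ) (x : V3) : V3 :=
  (8 * Real.pi)⁻¹ • ∫ t in (0:ℝ)..1,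
    (δ ^ 2 * ((‖x - X t‖ ^ 2 + δ ^ 2) ^ ((n : ℝ) / 2))⁻¹) • f t

/-- The scalar field `d_5^δ[f·R](x)`. -/
def dRegP (X f : ℝ → V3) (δ : ℝ) (x : V3) : ℝ :=
  (8 * Real.pi)⁻¹ * ∫ t in (0:ℝ)..1,
    δ ^ 2 * ⟪x - X t, f t⟫ * ((‖x - X t‖ ^ 2 + δ ^ 2) ^ ((5 : ℝ) / 2))⁻¹

/-- The extra force contribution
`F^δ(s) = ∫_0^{2π} (2E(d₃^δ[f])n − 3(ε²+δ²)E(d₅^δ[f])n − 3 d₅^δ[f·R] n) J_ε dθ`. -/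
def Fextra (X en1 en2 f : ℝ → V3) (ε δ s : ℝ) : V3 :=
  ∫ θ in (0:ℝ)..(2 * Real.pi),
    Jfac X en1 en2 ε s θ •
      ((2 : ℝ) • strainApply (dReg X f δ 3) (X s + ε • ePerp en1 en2 s θ)
          (-ePerp en1 en2 s θ)
        - (3 * (ε ^ 2 + δ ^ 2)) • strainApply (dReg X f δ 5)
            (X s + ε • ePerp en1 en2 s θ) (-ePerp en1 en2 s θ)
        - (3 * dRegP X f δ (X s + ε • ePerp en1 en2 s θ)) • (-ePerp en1 en2 s θ))

/-- A continuous function with period `1` is bounded by its `C⁰` norm. -/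
lemma norm_le_C0norm {f : ℝ → V3} (hf : Continuous f) (hp : ∀ s, f (s + 1) = f s) (s : ℝ) :
    ‖f s‖ ≤ C0norm f := by
  have hper : Function.Periodic (fun s => ‖f s‖) 1 := fun s => by simp only [hp s]
  have hcomp : IsCompact (Set.range fun s => ‖f s‖) :=
    hper.compact_of_continuous one_ne_zero hf.norm
  exact le_ciSup hcomp.bddAbove s

lemma C0norm_nonneg (f : ℝ → V3) : 0 ≤ C0norm f :=
  Real.iSup_nonneg fun _ => norm_nonneg _

lemma norm_le_C1norm {g : ℝ → V3} (hg : Continuous g) (hp : ∀ s, g (s + 1) = g s) (s : ℝ) :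
    ‖g s‖ ≤ C1norm g :=
  (norm_le_C0norm hg hp s).trans (le_add_of_nonneg_right (C0norm_nonneg _))

lemma norm_sub_zero_le_C1norm {g : ℝ → V3} (hg : ContDiff ℝ 1 g) (hp : ∀ s, g (s + 1) = g s)
    (t : ℝ) : ‖g t - g 0‖ ≤ C1norm g * |t| := by
  have hd : ∀ s, ‖deriv g s‖ ≤ C1norm g := fun s => by
    have hper : ∀ s, deriv g (s + 1) = deriv g s := fun s => by
      rw [← deriv_comp_add_const]
      congr 1
      exact funext hp
    exact (norm_le_C0norm (hg.continuous_deriv le_rfl) hper s).trans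
      (le_add_of_nonneg_left (C0norm_nonneg _))
  have h := Convex.norm_image_sub_le_of_norm_deriv_le (𝕜 := ℝ) (f := g) (s := Set.univ)
    (x := 0) (y := t) (C := C1norm g) (fun x _ => (hg.differentiable one_ne_zero) x)
    (fun x _ => hd x) convex_univ trivial trivial
  simpa using h

namespace SlenderGeom

variable {cΓ κmax : ℝ} {X en1 en2 : ℝ → V3}

lemma norm_sub_le (h : SlenderGeom cΓ κmax X en1 en2) (s t : ℝ) :
    ‖X s - X (s - t)‖ ≤ |t| := by
  have h := Convex.norm_image_sub_le_of_norm_deriv_le (𝕜 := ℝ) (f := X) (s := Set.univ)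
    (x := s - t) (y := s) (C := 1) (fun x _ => (h.smooth.differentiable two_ne_zero) x)
    (fun x _ => (h.arclength x).le) convex_univ trivial trivial
  simpa using h

/-- Second-order Taylor estimate for the centerline. -/
lemma norm_taylor_le (h : SlenderGeom cΓ κmax X en1 en2) (s t : ℝ) :
    ‖X s - X (s - t) - t • deriv X s‖ ≤ κmax * t ^ 2 := by
  have hκ : 0 ≤ κmax := (norm_nonneg _).trans (h.curvature_max 0)
  have hX' : ContDiff ℝ 1 (deriv X) :=
    (contDiff_succ_iff_deriv.1 (show ContDiff ℝ (1 + 1) X from h.smooth)).2.2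
  have hLip : ∀ u, ‖deriv X (s - u) - deriv X s‖ ≤ κmax * |u| := fun u => by
    have h := Convex.norm_image_sub_le_of_norm_deriv_le (𝕜 := ℝ) (f := deriv X)
      (s := Set.univ) (x := s) (y := s - u) (C := κmax)
      (fun x _ => (hX'.differentiable one_ne_zero) x)
      (fun x _ => h.curvature_max x) convex_univ trivial trivial
    simpa using h
  have hder : ∀ u, HasDerivAt (fun u => X s - X (s - u) - u • deriv X s)
      (deriv X (s - u) - deriv X s) u := fun u => by
    have h1 : HasDerivAt X (deriv X (s - u)) (s - u) :=
      ((h.smooth.differentiable two_ne_zero) _).hasDerivAt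
    have h2 := ((h1.comp_const_sub s u).const_sub (X s)).sub
      ((hasDerivAt_id u).smul_const (deriv X s))
    refine h2.congr_deriv ?_
    simp
  have hmv := (convex_uIcc (0 : ℝ) t).norm_image_sub_le_of_norm_hasDerivWithin_le
    (f := fun u => X s - X (s - u) - u • deriv X s) (C := κmax * |t|)
    (fun u _ => (hder u).hasDerivWithinAt)
    (fun u hu => (hLip u).trans (mul_le_mul_of_nonneg_left
      (by simpa using Set.abs_sub_left_of_mem_uIcc hu) hκ))
    Set.left_mem_uIcc Set.right_mem_uIcc
  simp only [sub_zero, sub_self, zero_smul, Real.norm_eq_abs] at hmv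
  calc _ ≤ κmax * |t| * |t| := hmv
    _ = κmax * t ^ 2 := by rw [mul_assoc, abs_mul_abs_self, sq]

lemma norm_ePerp (h : SlenderGeom cΓ κmax X en1 en2) (s θ : ℝ) : ‖ePerp en1 en2 s θ‖ = 1 := by
  have : ‖ePerp en1 en2 s θ‖ ^ 2 = 1 := by
    rw [ePerp, norm_add_sq_real, norm_smul, norm_smul, real_inner_smul_left,
      real_inner_smul_right, h.en1_en2, h.en1_unit, h.en2_unit]
    simp
  nlinarith [norm_nonneg (ePerp en1 en2 s θ)]

lemma abs_inner_ePerp_le (h : SlenderGeom cΓ κmax X en1 en2) (s t θ : ℝ) :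
    |⟪X s - X (s - t), ePerp en1 en2 s θ⟫| ≤ κmax * t ^ 2 := by
  have h0 : ⟪deriv X s, ePerp en1 en2 s θ⟫ = 0 := by
    rw [ePerp, inner_add_right, real_inner_smul_right, real_inner_smul_right, h.es_en1, h.es_en2]
    simp
  have h1 : ⟪X s - X (s - t), ePerp en1 en2 s θ⟫
      = ⟪X s - X (s - t) - t • deriv X s, ePerp en1 en2 s θ⟫ := by
    rw [inner_sub_left _ (t • _), real_inner_smul_left, h0]; simp
  rw [h1]
  refine (abs_real_inner_le_norm _ _).trans ?_
  rw [h.norm_ePerp, mul_one]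
  exact h.norm_taylor_le s t

lemma norm_Rvec_sq (h : SlenderGeom cΓ κmax X en1 en2) (ε s t θ : ℝ) :
    ‖Rvec X en1 en2 ε s t θ‖ ^ 2 = ‖X s - X (s - t)‖ ^ 2
      + 2 * ε * ⟪X s - X (s - t), ePerp en1 en2 s θ⟫ + ε ^ 2 := by
  have : Rvec X en1 en2 ε s t θ = (X s - X (s - t)) + ε • ePerp en1 en2 s θ := by
    rw [Rvec]; abel
  rw [this, norm_add_sq_real, norm_smul, real_inner_smul_right, h.norm_ePerp, mul_one,
    Real.norm_eq_abs, sq_abs]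
  ring

/-- The squared distance differs from that of the straight centerline by a relative error
of order `|t|`. -/
lemma abs_norm_Rvec_sq_sub_le (h : SlenderGeom cΓ κmax X en1 en2) {ε : ℝ} (hε : 0 < ε)
    (s t θ : ℝ) :
    |‖Rvec X en1 en2 ε s t θ‖ ^ 2 - (t ^ 2 + ε ^ 2)| ≤ 4 * κmax * |t| * (t ^ 2 + ε ^ 2) := by
  have hκ : 0 ≤ κmax := (norm_nonneg _).trans (h.curvature_max 0)
  have hY : |‖X s - X (s - t)‖ - (|t|)| ≤ κmax * t ^ 2 := by
    have h1 := abs_norm_sub_norm_le (X s - X (s - t)) (t • deriv X s)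
    rw [norm_smul, h.arclength, mul_one, Real.norm_eq_abs] at h1
    exact h1.trans (h.norm_taylor_le s t)
  have hY2 : |‖X s - X (s - t)‖ ^ 2 - t ^ 2| ≤ κmax * t ^ 2 * (2 * |t|) := by
    rw [← sq_abs t, sq_sub_sq, abs_mul, mul_comm]
    refine mul_le_mul (by simpa using hY) ?_ (abs_nonneg _) (by positivity)
    rw [abs_of_nonneg (by positivity)]
    linarith [h.norm_sub_le s t]
  have hI := h.abs_inner_ePerp_le s t θ
  rw [h.norm_Rvec_sq]
  calc _ = |(‖X s - X (s - t)‖ ^ 2 - t ^ 2)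
        + 2 * ε * ⟪X s - X (s - t), ePerp en1 en2 s θ⟫| := by congr 1; ring
    _ ≤ κmax * t ^ 2 * (2 * |t|) + 2 * ε * (κmax * t ^ 2) := by
        refine (abs_add_le _ _).trans (add_le_add hY2 ?_)
        rw [abs_mul, abs_of_pos (by positivity : 0 < 2 * ε)]
        gcongr
    _ = κmax * |t| * (2 * t ^ 2 + 2 * (ε * |t|)) := by rw [← sq_abs t]; ring
    _ ≤ κmax * |t| * (4 * (t ^ 2 + ε ^ 2)) := by
        gcongr
        nlinarith [sq_nonneg (ε - |t|), sq_abs t, sq_nonneg ε, sq_nonneg t]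
    _ = _ := by ring

lemma le_norm_Rvec_sq (h : SlenderGeom cΓ κmax X en1 en2) (hcΓ : 0 < cΓ) {ε : ℝ} (hε : 0 < ε)
    (hεκ : 4 * κmax * ε ≤ cΓ ^ 2) {t : ℝ} (ht : |t| ≤ 1 / 2) (s θ : ℝ) :
    cΓ ^ 2 / 2 * t ^ 2 + ε ^ 2 ≤ ‖Rvec X en1 en2 ε s t θ‖ ^ 2 := by
  have h1 : cΓ * |t| ≤ ‖X s - X (s - t)‖ := by
    simpa using h.no_self_intersect s (s - t) (by simpa using ht)
  have h2 : cΓ ^ 2 * t ^ 2 ≤ ‖X s - X (s - t)‖ ^ 2 := by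
    rw [← sq_abs t, ← mul_pow]
    gcongr
  have h3 := neg_le_of_abs_le (h.abs_inner_ePerp_le s t θ)
  rw [h.norm_Rvec_sq]
  nlinarith [mul_le_mul_of_nonneg_left h3 hε.le, mul_le_mul_of_nonneg_right hεκ (sq_nonneg t)]

lemma continuous_Rvec (h : SlenderGeom cΓ κmax X en1 en2) (ε s θ : ℝ) :
    Continuous fun t => Rvec X en1 en2 ε s t θ := by
  have := h.smooth.continuous
  unfold Rvec
  fun_prop

end SlenderGeom

/-- Comparison of inverse powers of two comparable positive numbers. -/
lemma abs_inv_rpow_sub_inv_rpow_le {c q A B : ℝ} (hc : 0 < c) (hc1 : c ≤ 1) (hq : 0 ≤ q)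
    (hB : 0 < B) (hA : c * B ≤ A) :
    |(A ^ q)⁻¹ - (B ^ q)⁻¹| ≤ q * c ^ (-q - 1) * B ^ (-q - 1) * |A - B| := by
  have hcB : 0 < c * B := mul_pos hc hB
  have h := (convex_Ici (c * B)).norm_image_sub_le_of_norm_hasDerivWithin_le
    (f := fun x : ℝ => x ^ (-q)) (f' := fun x => -q * x ^ (-q - 1))
    (C := q * (c * B) ^ (-q - 1)) (x := B) (y := A)
    (fun x hx => (Real.hasDerivAt_rpow_const
      (Or.inl (hcB.trans_le hx).ne')).hasDerivWithinAt)
    (fun x hx => by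
      rw [norm_mul, norm_neg, Real.norm_of_nonneg hq,
        Real.norm_of_nonneg (Real.rpow_nonneg (hcB.trans_le hx).le _)]
      exact mul_le_mul_of_nonneg_left
        (Real.rpow_le_rpow_of_nonpos hcB hx (by linarith)) hq)
    (Set.mem_Ici.2 (by nlinarith)) (Set.mem_Ici.2 hA)
  rw [← Real.rpow_neg (hcB.trans_le hA).le, ← Real.rpow_neg hB.le]
  rw [Real.mul_rpow hc.le hB.le, ← mul_assoc] at h
  exact h

/-- Bounding an integral over a symmetric interval after subtracting the value at `0` against
an odd scalar kernel. -/
lemma norm_integral_le_of_odd_sub {E : Type*} [NormedAddCommGroup E] [NormedSpace ℝ E] [CompleteSpace E]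
    {F : ℝ → E} {k b : ℝ → ℝ} {a : ℝ} (ha : 0 ≤ a) (v : E)
    (hF : IntervalIntegrable F volume (-a) a) (hk : IntervalIntegrable k volume (-a) a)
    (hb : IntervalIntegrable b volume (-a) a) (hodd : ∀ t, k (-t) = -k t)
    (hle : ∀ t, |t| ≤ a → ‖F t - k t • v‖ ≤ b t) :
    ‖∫ t in (-a)..a, F t‖ ≤ ∫ t in (-a)..a, b t := by
  have hkv : ∫ t in (-a)..a, k t • v = 0 := by
    have h0 : ∫ t in (-a)..a, k t = 0 := by
      have h1 : ∫ t in (-a)..a, k (-t) = ∫ t in (-a)..a, k t := by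
        rw [intervalIntegral.integral_comp_neg, neg_neg]
      simp only [hodd, intervalIntegral.integral_neg] at h1
      linarith
    rw [intervalIntegral.integral_smul_const, h0, zero_smul]
  have hsub := intervalIntegral.integral_sub hF ⟨hk.1.smul_const v, hk.2.smul_const v⟩
  rw [hkv, sub_zero] at hsub
  rw [← hsub]
  exact intervalIntegral.norm_integral_le_of_norm_le (by linarith)
    (Filter.Eventually.of_forall fun t ht => hle t (abs_le.2 ⟨ht.1.le, ht.2⟩)) hb

lemma integral_inv_sq_add_sq_le {a : ℝ} (ha : 0 < a) (x y : ℝ) :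
    ∫ t in x..y, (t ^ 2 + a ^ 2)⁻¹ ≤ Real.pi / a := by
  have hderiv : ∀ t ∈ Set.uIcc x y,
      HasDerivAt (fun t => a⁻¹ * Real.arctan (t / a)) ((t ^ 2 + a ^ 2)⁻¹) t := fun t _ => by
    have h := (((hasDerivAt_id t).div_const a).arctan).const_mul a⁻¹
    refine h.congr_deriv ?_
    have : t ^ 2 + a ^ 2 ≠ 0 := by positivity
    have : 1 + (t / a) ^ 2 ≠ 0 := by positivity
    simp only [id]
    field_simp
    ring
  have hcont : Continuous fun t : ℝ => (t ^ 2 + a ^ 2)⁻¹ :=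
    Continuous.inv₀ (by fun_prop) fun t => by positivity
  rw [intervalIntegral.integral_eq_sub_of_hasDerivAt hderiv (hcont.intervalIntegrable _ _),
    ← mul_sub, inv_mul_eq_div]
  gcongr
  linarith [Real.arctan_lt_pi_div_two (y / a), Real.neg_pi_div_two_lt_arctan (x / a)]

lemma abs_pow_mul_inv_rpow_le (k : ℕ) (q : ℝ) {t α : ℝ} (hα : 0 < α) :
    |t| ^ k * ((t ^ 2 + α) ^ q)⁻¹ ≤ (t ^ 2 + α) ^ ((k : ℝ) / 2 - q) := by
  have hB : 0 < t ^ 2 + α := by positivity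
  have ht : |t| ^ k ≤ (t ^ 2 + α) ^ ((k : ℝ) / 2) := by
    have h1 : |t| ≤ (t ^ 2 + α) ^ ((1 : ℝ) / 2) := by
      rw [← Real.sqrt_eq_rpow]
      exact Real.abs_le_sqrt (by linarith)
    calc |t| ^ k ≤ ((t ^ 2 + α) ^ ((1 : ℝ) / 2)) ^ k := by gcongr
      _ = _ := by
        rw [← Real.rpow_natCast, ← Real.rpow_mul hB.le]
        congr 1
        ring
  rw [Real.rpow_sub hB, div_eq_mul_inv]
  gcongr

/-- `C¹` densities against an odd power times the kernel: one power of `t` is gained. -/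
lemma norm_kernel_integral_le (m n : ℕ) (hm : Odd m) {cΓ κmax : ℝ} (hcΓ : 0 < cΓ) {c : ℝ}
    (hc : 0 < c) (hc1 : c ≤ 1) (hcc : c ≤ cΓ ^ 2 / 2) {X en1 en2 g : ℝ → V3}
    (h : SlenderGeom cΓ κmax X en1 en2) (hg : ContDiff ℝ 1 g) (hp : ∀ s, g (s + 1) = g s)
    {ε δ : ℝ} (hε : 0 < ε) (hεκ : 4 * κmax * ε ≤ cΓ ^ 2) (hδ : 0 < δ) (s θ : ℝ) :
    ‖∫ sb in (-(1:ℝ)/2)..(1/2),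
        (sb ^ m * ((‖Rvec X en1 en2 ε s sb θ‖ ^ 2 + δ ^ 2) ^ ((n : ℝ) / 2))⁻¹) • g sb‖
      ≤ ((n : ℝ) / 2 * c ^ (-((n : ℝ) / 2) - 1) * (4 * κmax) + 1) * C1norm g *
        ∫ t in (-(1:ℝ)/2)..(1/2),
          |t| ^ (m + 1) * ((t ^ 2 + (ε ^ 2 + δ ^ 2)) ^ ((n : ℝ) / 2))⁻¹ := by
  have hκ : 0 ≤ κmax := (norm_nonneg _).trans (h.curvature_max 0)
  have hG : 0 ≤ C1norm g := add_nonneg (C0norm_nonneg _) (C0norm_nonneg _)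
  set q : ℝ := (n : ℝ) / 2 with hq_def
  have hq : 0 ≤ q := by positivity
  have hB : ∀ t : ℝ, 0 < t ^ 2 + (ε ^ 2 + δ ^ 2) := fun t => by positivity
  have hAB : ∀ t : ℝ, |t| ≤ 1 / 2 → c * (t ^ 2 + (ε ^ 2 + δ ^ 2))
      ≤ ‖Rvec X en1 en2 ε s t θ‖ ^ 2 + δ ^ 2 := fun t ht => by
    have := h.le_norm_Rvec_sq hcΓ hε hεκ ht s θ
    nlinarith [mul_le_mul_of_nonneg_right hcc (sq_nonneg t),
      mul_le_mul_of_nonneg_right hc1 (sq_nonneg ε), mul_le_mul_of_nonneg_right hc1 (sq_nonneg δ)]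
  have hA0 : ∀ t : ℝ, 0 < ‖Rvec X en1 en2 ε s t θ‖ ^ 2 + δ ^ 2 := fun t => by positivity
  have hAc : Continuous fun t => ((‖Rvec X en1 en2 ε s t θ‖ ^ 2 + δ ^ 2) ^ q)⁻¹ :=
    ((((h.continuous_Rvec ε s θ).norm.pow 2).add continuous_const).rpow_const
      fun t => Or.inl (hA0 t).ne').inv₀ fun t => (Real.rpow_pos_of_pos (hA0 t) _).ne'
  have hBc : Continuous fun t : ℝ => ((t ^ 2 + (ε ^ 2 + δ ^ 2)) ^ q)⁻¹ :=
    (((continuous_pow 2).add continuous_const).rpow_const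
      fun t => Or.inl (hB t).ne').inv₀ fun t => (Real.rpow_pos_of_pos (hB t) _).ne'
  have hgc := hg.continuous
  rw [neg_div, ← intervalIntegral.integral_const_mul]
  refine norm_integral_le_of_odd_sub (by norm_num) (g 0)
    (k := fun t => t ^ m * ((t ^ 2 + (ε ^ 2 + δ ^ 2)) ^ q)⁻¹)
    (Continuous.intervalIntegrable (by fun_prop) _ _)
    (Continuous.intervalIntegrable (by fun_prop) _ _)
    (Continuous.intervalIntegrable (by fun_prop) _ _)
    (fun t => by rw [hm.neg_pow, neg_sq, neg_mul]) (fun t ht => ?_)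
  have hcmp := abs_inv_rpow_sub_inv_rpow_le hc hc1 hq (hB t) (hAB t ht)
  have hdiff := h.abs_norm_Rvec_sq_sub_le hε s t θ
  set A := ‖Rvec X en1 en2 ε s t θ‖ ^ 2 + δ ^ 2 with hA_def
  set B := t ^ 2 + (ε ^ 2 + δ ^ 2) with hB_def
  have hBpos : 0 < B := hB t
  have hABle : |A - B| ≤ 4 * κmax * |t| * B := by
    calc |A - B| = |‖Rvec X en1 en2 ε s t θ‖ ^ 2 - (t ^ 2 + ε ^ 2)| := by
          congr 1; rw [hA_def, hB_def]; ring
      _ ≤ _ := hdiff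
      _ ≤ _ := by gcongr; rw [hB_def]; nlinarith [sq_nonneg δ]
  have hker : |(A ^ q)⁻¹ - (B ^ q)⁻¹| ≤ q * c ^ (-q - 1) * (4 * κmax) * |t| * (B ^ q)⁻¹ := by
    calc _ ≤ q * c ^ (-q - 1) * B ^ (-q - 1) * (4 * κmax * |t| * B) := by
          refine hcmp.trans ?_
          gcongr
      _ = _ := by
        rw [Real.rpow_sub_one hBpos.ne', Real.rpow_neg hBpos.le]
        field_simp
  have hsplit : (t ^ m * (A ^ q)⁻¹) • g t - (t ^ m * (B ^ q)⁻¹) • g 0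
      = t ^ m • (((A ^ q)⁻¹ - (B ^ q)⁻¹) • g t + (B ^ q)⁻¹ • (g t - g 0)) := by
    module
  rw [hsplit, norm_smul, norm_pow, Real.norm_eq_abs]
  calc _ ≤ |t| ^ m * (q * c ^ (-q - 1) * (4 * κmax) * |t| * (B ^ q)⁻¹ * C1norm g
          + (B ^ q)⁻¹ * (C1norm g * |t|)) := by
        gcongr
        refine (norm_add_le _ _).trans (add_le_add ?_ ?_)
        · rw [norm_smul, Real.norm_eq_abs]
          exact mul_le_mul hker (norm_le_C1norm hgc hp t) (norm_nonneg _) (by positivity)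
        · rw [norm_smul, Real.norm_of_nonneg (by positivity)]
          gcongr
          exact norm_sub_zero_le_C1norm hg hp t
    _ = _ := by ring

lemma integral_abs_pow_mul_inv_rpow_le_one (m : ℕ) {α : ℝ} (hα : 0 < α) :
    ∫ t in (-(1:ℝ)/2)..(1/2), |t| ^ (m + 1) * ((t ^ 2 + α) ^ (((m + 1 : ℕ) : ℝ) / 2))⁻¹ ≤ 1 := by
  have h := intervalIntegral.norm_integral_le_of_norm_le_const (a := -(1:ℝ)/2) (b := 1/2) (C := 1)
    (f := fun t => |t| ^ (m + 1) * ((t ^ 2 + α) ^ (((m + 1 : ℕ) : ℝ) / 2))⁻¹) fun t _ => by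
      have hB : 0 < t ^ 2 + α := by positivity
      rw [Real.norm_of_nonneg (by positivity)]
      simpa using abs_pow_mul_inv_rpow_le (m + 1) (((m + 1 : ℕ) : ℝ) / 2) (t := t) hα
  refine (le_abs_self _).trans (h.trans ?_)
  norm_num

lemma integral_abs_pow_mul_inv_rpow_le (m n : ℕ) (hn : m + 3 ≤ n) {α : ℝ} (hα : 0 < α) :
    ∫ t in (-(1:ℝ)/2)..(1/2), |t| ^ (m + 1) * ((t ^ 2 + α) ^ ((n : ℝ) / 2))⁻¹
      ≤ Real.pi * α ^ (((m : ℝ) + 2 - n) / 2) := by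
  have hn' : (m : ℝ) + 3 ≤ n := by exact_mod_cast hn
  have hB : ∀ t : ℝ, 0 < t ^ 2 + α := fun t => by positivity
  have hcont : Continuous fun t : ℝ => ((t ^ 2 + α) ^ ((n : ℝ) / 2))⁻¹ :=
    (((continuous_pow 2).add continuous_const).rpow_const
      fun t => Or.inl (hB t).ne').inv₀ fun t => (Real.rpow_pos_of_pos (hB t) _).ne'
  have hinv : Continuous fun t : ℝ => (t ^ 2 + α)⁻¹ :=
    Continuous.inv₀ (by fun_prop) fun t => (hB t).ne'
  set r : ℝ := ((m : ℝ) + 3 - n) / 2 with hr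
  calc _ ≤ ∫ t in (-(1:ℝ)/2)..(1/2), α ^ r * (t ^ 2 + α)⁻¹ := by
        refine intervalIntegral.integral_mono_on (by norm_num)
          (Continuous.intervalIntegrable (by fun_prop) _ _)
          (Continuous.intervalIntegrable (by fun_prop) _ _) fun t _ => ?_
        refine (abs_pow_mul_inv_rpow_le (m + 1) _ hα).trans ?_
        have he : ((m + 1 : ℕ) : ℝ) / 2 - (n : ℝ) / 2 = r - 1 := by push_cast; rw [hr]; ring
        rw [he, Real.rpow_sub_one (hB t).ne', div_eq_mul_inv]
        exact mul_le_mul_of_nonneg_right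
          (Real.rpow_le_rpow_of_nonpos hα (by nlinarith [sq_nonneg t]) (by rw [hr]; linarith))
          (inv_nonneg.2 (hB t).le)
    _ ≤ α ^ r * (Real.pi / √α) := by
        rw [intervalIntegral.integral_const_mul]
        gcongr
        have := integral_inv_sq_add_sq_le (Real.sqrt_pos.2 hα) (-(1:ℝ)/2) (1/2)
        rwa [Real.sq_sqrt hα.le] at this
    _ = _ := by
        have he : ((m : ℝ) + 2 - n) / 2 = r - 1 / 2 := by rw [hr]; ring
        rw [he, Real.rpow_sub hα, Real.sqrt_eq_rpow]
        ring

/-- Refined bound for odd-power kernel integrals against `C¹` densities: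
for odd `m > 0`, if `n = m+1` the integral is `O(‖g‖_{C¹}|log(ε²+δ²)|)`, and if
`n ≥ m+3` it is `O(‖g‖_{C¹}(ε²+δ²)^{(m+2−n)/2})`. -/
theorem kernel_integral_odd_refined (m n : ℕ) (hm : Odd m) (hm0 : 0 < m)
    (cΓ κmax : ℝ) (hcΓ : 0 < cΓ) :
    ∃ C > 0, ∃ ε₀ > 0,
      ∀ X en1 en2 : ℝ → V3, SlenderGeom cΓ κmax X en1 en2 →
      ∀ g : ℝ → V3, ContDiff ℝ 1 g → (∀ s, g (s + 1) = g s) →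
      ∀ ε δ : ℝ, 0 < ε → ε < ε₀ → 0 < δ → δ < ε₀ →
      ∀ s θ : ℝ,
        (n = m + 1 →
          ‖∫ sb in (-(1:ℝ)/2)..(1/2),
              (sb ^ m * ((‖Rvec X en1 en2 ε s sb θ‖ ^ 2 + δ ^ 2) ^ ((n : ℝ) / 2))⁻¹)
                • g sb‖
            ≤ C * C1norm g * |Real.log (ε ^ 2 + δ ^ 2)|) ∧
        (m + 3 ≤ n →
          ‖∫ sb in (-(1:ℝ)/2)..(1/2),
              (sb ^ m * ((‖Rvec X en1 en2 ε s sb θ‖ ^ 2 + δ ^ 2) ^ ((n : ℝ) / 2))⁻¹)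
                • g sb‖
            ≤ C * C1norm g * (ε ^ 2 + δ ^ 2) ^ (((m : ℝ) + 2 - n) / 2)) := by
  set c : ℝ := min 1 (cΓ ^ 2 / 2)
  have hc : 0 < c := lt_min one_pos (by positivity)
  set D : ℝ := (n : ℝ) / 2 * c ^ (-((n : ℝ) / 2) - 1) * (4 * |κmax|) + 1
  have hD : 0 < D := by positivity
  refine ⟨D * Real.pi, by positivity, min (1 / 4) (cΓ ^ 2 / (4 * (|κmax| + 1))),
    lt_min (by norm_num) (by positivity), ?_⟩
  intro X en1 en2 h g hg hp ε δ hε hε0 hδ hδ0 s θ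
  have hκ : 0 ≤ κmax := (norm_nonneg _).trans (h.curvature_max 0)
  have hG : 0 ≤ C1norm g := add_nonneg (C0norm_nonneg _) (C0norm_nonneg _)
  have hε1 : ε < 1 / 4 := hε0.trans_le (min_le_left _ _)
  have hδ1 : δ < 1 / 4 := hδ0.trans_le (min_le_left _ _)
  have hεκ : 4 * κmax * ε ≤ cΓ ^ 2 := by
    have h1 : ε < cΓ ^ 2 / (4 * (|κmax| + 1)) := hε0.trans_le (min_le_right _ _)
    rw [lt_div_iff₀ (by positivity), abs_of_nonneg hκ] at h1
    linarith
  have hα : 0 < ε ^ 2 + δ ^ 2 := by positivity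
  have hmain := norm_kernel_integral_le m n hm hcΓ hc (min_le_left _ _) (min_le_right _ _)
    h hg hp hε hεκ hδ s θ
  rw [← abs_of_nonneg hκ] at hmain
  refine ⟨fun hn => ?_, fun hn => ?_⟩
  · subst hn
    have hlog : 1 ≤ |Real.log (ε ^ 2 + δ ^ 2)| := by
      have h1 : Real.log (ε ^ 2 + δ ^ 2) ≤ -1 := by
        rw [Real.log_le_iff_le_exp hα]
        have h2 : ε ^ 2 + δ ^ 2 ≤ 1 / 8 := by nlinarith
        have h3 : (1 : ℝ) / 8 ≤ Real.exp (-1) := by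
          rw [Real.exp_neg, one_div]
          gcongr
          linarith [Real.exp_one_lt_d9]
        exact h2.trans h3
      rw [abs_of_nonpos (by linarith)]
      linarith
    calc _ ≤ D * C1norm g * 1 := hmain.trans (mul_le_mul_of_nonneg_left
            (integral_abs_pow_mul_inv_rpow_le_one m hα) (by positivity))
      _ ≤ D * C1norm g * (Real.pi * |Real.log (ε ^ 2 + δ ^ 2)|) := by
          gcongr
          nlinarith [Real.pi_gt_three]
      _ = _ := by ring
  · calc _ ≤ D * C1norm g * (Real.pi * (ε ^ 2 + δ ^ 2) ^ (((m : ℝ) + 2 - n) / 2)) :=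
          hmain.trans (mul_le_mul_of_nonneg_left
            (integral_abs_pow_mul_inv_rpow_le m n hn hα) (by positivity))
      _ = _ := by ring
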